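/- Suppose β = β₁^m < β₂^m. Then for m-a.e. θ ∈ Θ: 𝒜_β(θ) = {0}, and there exists a set J(θ) ⊆ ℕ of asymptotic density 0 (i.e. lim_{n→∞} #(J(θ) ∩ {0,…,n−1})/n = 0) such that lim_{n→∞, n∉J(θ)} ‖f^n_{β,θ}(v)‖ = 0 for all v ∈ ℝ². -/

import Mathlib

open Filter MeasureTheory Metric Set
open scoped Topology

noncomputable section

/-- ℝ² with the Euclidean norm. -/
abbrev R2 : Type := EuclideanSpace ℝ (Fin 2)

/-- Action of a 2×2 real matrix on Euclidean ℝ². -/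
def mulVecE (M : Matrix (Fin 2) (Fin 2) ℝ) (v : R2) : R2 :=
  (WithLp.equiv 2 (Fin 2 → ℝ)).symm (M.mulVec ((WithLp.equiv 2 (Fin 2 → ℝ)) v))

/-- Operator norm of a 2×2 real matrix induced by the Euclidean norm on ℝ². -/
def opNorm (M : Matrix (Fin 2) (Fin 2) ℝ) : ℝ :=
  ‖(Matrix.toEuclideanCLM (𝕜 := ℝ) M : R2 →L[ℝ] R2)‖

/-- The cocycle `A_n(θ) = A(γ^{n-1}θ) ⋯ A(θ)`. -/
def coc {Θ : Type*} (γ : Θ → Θ) (A : Θ → Matrix (Fin 2) (Fin 2) ℝ) :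
    ℕ → Θ → Matrix (Fin 2) (Fin 2) ℝ
  | 0, _ => 1
  | n + 1, θ => coc γ A n (γ θ) * A θ

/-- Maximal Lyapunov exponent `λ_max(A) = sup_θ limsup (1/n) log‖A_n(θ)‖`. -/
def lyapMax {Θ : Type*} (γ : Θ → Θ) (A : Θ → Matrix (Fin 2) (Fin 2) ℝ) : ℝ :=
  ⨆ θ : Θ, Filter.limsup (fun n : ℕ => Real.log (opNorm (coc γ A n θ)) / n) Filter.atTop

/-- The hypotheses on `h`: C² on [0,∞), strictly increasing, strictly concave, bounded,
nonnegative, `h 0 = 0`, `h' 0 = 1`. -/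
def GoodH (h : ℝ → ℝ) : Prop :=
  ContDiffOn ℝ 2 h (Set.Ici 0) ∧ StrictMonoOn h (Set.Ici 0) ∧
    StrictConcaveOn ℝ (Set.Ici 0) h ∧ BddAbove (h '' Set.Ici 0) ∧
    (∀ x ∈ Set.Ici (0 : ℝ), 0 ≤ h x) ∧ h 0 = 0 ∧ derivWithin h (Set.Ici 0) 0 = 1

/-- The scaling condition `sup_{x ≥ 0} h(x) ≤ (sup_θ ‖A(θ)‖)⁻¹`. -/
def Scaled {Θ : Type*} (A : Θ → Matrix (Fin 2) (Fin 2) ℝ) (h : ℝ → ℝ) : Prop :=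
  ∀ x ∈ Set.Ici (0 : ℝ), h x ≤ (⨆ θ : Θ, opNorm (A θ))⁻¹

open scoped Classical in
/-- The fibre maps `f_{β,θ}(v) = h(β‖v‖)·A(θ)·v/‖v‖`, `f_{β,θ}(0) = 0`. -/
def fibMap {Θ : Type*} (A : Θ → Matrix (Fin 2) (Fin 2) ℝ) (h : ℝ → ℝ) (β : ℝ)
    (θ : Θ) (v : R2) : R2 :=
  if v = 0 then 0 else (h (β * ‖v‖) / ‖v‖) • mulVecE (A θ) v

/-- The skew product `f_β(θ,v) = (γθ, f_{β,θ}(v))`. -/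
def skewProd {Θ : Type*} (γ : Θ → Θ) (A : Θ → Matrix (Fin 2) (Fin 2) ℝ) (h : ℝ → ℝ)
    (β : ℝ) : Θ × R2 → Θ × R2 :=
  fun p => (γ p.1, fibMap A h β p.1 p.2)

/-- The global attractor `𝒜_β = ⋂_{n∈ℕ} f_β^n(Θ × B̄₁(0))`. -/
def globalAttractor {Θ : Type*} (γ : Θ → Θ) (A : Θ → Matrix (Fin 2) (Fin 2) ℝ)
    (h : ℝ → ℝ) (β : ℝ) : Set (Θ × R2) :=
  ⋂ n : ℕ, (skewProd γ A h β)^[n] '' (Set.univ ×ˢ Metric.closedBall (0 : R2) 1)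

/-- The fibre `𝒜_β(θ) = {x : (θ,x) ∈ 𝒜_β}` of the global attractor. -/
def attractorFib {Θ : Type*} (γ : Θ → Θ) (A : Θ → Matrix (Fin 2) (Fin 2) ℝ)
    (h : ℝ → ℝ) (β : ℝ) (θ : Θ) : Set R2 :=
  {x : R2 | (θ, x) ∈ globalAttractor γ A h β}

/-- `v(α) = (cos 2πα, sin 2πα)ᵗ`. -/
def vFull (α : ℝ) : R2 :=
  (WithLp.equiv 2 (Fin 2 → ℝ)).symm ![Real.cos (2 * Real.pi * α), Real.sin (2 * Real.pi * α)]

/-- `(cos πα, sin πα)ᵗ`, representing the projective point `α ∈ 𝕋 ≅ ℝP¹`. -/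
def vHalf (α : ℝ) : R2 :=
  (WithLp.equiv 2 (Fin 2 → ℝ)).symm ![Real.cos (Real.pi * α), Real.sin (Real.pi * α)]

/-- The projective angle coordinate `p(w) = (1/π)·arg(w) mod 1 ∈ [0,1)` of a nonzero
vector `w ∈ ℝ²`; for `w ≠ 0` this equals `(1/π)·arctan(w₂/w₁) mod 1`. -/
def projAngle (w : R2) : ℝ :=
  Int.fract (Complex.arg (Complex.ofReal (w 0) + Complex.ofReal (w 1) * Complex.I) / Real.pi)

/-- The projective action `g(θ,α) = (γθ, g_θ(α))` of the cocycle on `Θ × 𝕋`,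
where `𝕋` is modelled by the fundamental domain `[0,1) ⊆ ℝ`. -/
def gMap {Θ : Type*} (γ : Θ → Θ) (A : Θ → Matrix (Fin 2) (Fin 2) ℝ) :
    Θ × ℝ → Θ × ℝ :=
  fun p => (γ p.1, projAngle (mulVecE (A p.1) (vHalf p.2)))

/-- `Ω(θ,α) = ‖A(θ)(cos πα, sin πα)ᵗ‖`. -/
def Omega {Θ : Type*} (A : Θ → Matrix (Fin 2) (Fin 2) ℝ) (p : Θ × ℝ) : ℝ :=
  ‖mulVecE (A p.1) (vHalf p.2)‖

/-- The fibre maps `F_{β,θ,α}(r) = h(βr)·Ω(θ,α)` of the double skew product. -/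
def dsFib {Θ : Type*} (A : Θ → Matrix (Fin 2) (Fin 2) ℝ) (h : ℝ → ℝ) (β : ℝ)
    (p : Θ × ℝ) (r : ℝ) : ℝ :=
  h (β * r) * Omega A p

/-- The double skew product `F_β(θ,α,r) = (g(θ,α), h(βr)·Ω(θ,α))` on `Θ × 𝕋 × [0,∞)`. -/
def dsMap {Θ : Type*} (γ : Θ → Θ) (A : Θ → Matrix (Fin 2) (Fin 2) ℝ) (h : ℝ → ℝ)
    (β : ℝ) : Θ × ℝ × ℝ → Θ × ℝ × ℝ :=
  fun p => ((gMap γ A (p.1, p.2.1)).1, (gMap γ A (p.1, p.2.1)).2, dsFib A h β (p.1, p.2.1) p.2.2)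

/-- `Ω_n(θ,α) = ∏_{i=0}^{n-1} Ω(g^i(θ,α))`. -/
def OmegaProd {Θ : Type*} (γ : Θ → Θ) (A : Θ → Matrix (Fin 2) (Fin 2) ℝ) (n : ℕ)
    (p : Θ × ℝ) : ℝ :=
  ∏ i ∈ Finset.range n, Omega A ((gMap γ A)^[i] p)

/-- `Γ(a,b) = inf_{a ≤ x ≤ 1} inf_{0 < q ≤ b} h(qx)/(q·h(x))`. -/
def GammaH (h : ℝ → ℝ) (a b : ℝ) : ℝ :=
  sInf {y : ℝ | ∃ x ∈ Set.Icc a 1, ∃ q ∈ Set.Ioc (0 : ℝ) b, y = h (q * x) / (q * h x)}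

/-- The inverse `g⁻¹(θ,α) = (γ⁻¹θ, projective angle of A(γ⁻¹θ)⁻¹·v(α))` of the
projective action. -/
def gInv {Θ : Type*} (γinv : Θ → Θ) (A : Θ → Matrix (Fin 2) (Fin 2) ℝ) :
    Θ × ℝ → Θ × ℝ :=
  fun p => (γinv p.1, projAngle (mulVecE (A (γinv p.1))⁻¹ (vHalf p.2)))

/-- `F^n_{β,g^{-n}(θ,α)}(1)`, the pullback iterate defining the upper bounding graph. -/
def pullback1 {Θ : Type*} (γ : Θ → Θ) (γinv : Θ → Θ) (A : Θ → Matrix (Fin 2) (Fin 2) ℝ)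
    (h : ℝ → ℝ) (β : ℝ) (n : ℕ) (p : Θ × ℝ) : ℝ :=
  ((dsMap γ A h β)^[n] (((gInv γinv A)^[n] p).1, ((gInv γinv A)^[n] p).2, 1)).2.2

/-- The running maxima `max_{1 ≤ k ≤ n+1} S_k ψ` of the Birkhoff sums of `ψ`. -/
def birkhoffMax {Θ : Type*} (γ : Θ → Θ) (ψ : Θ → ℝ) : ℕ → Θ → ℝ
  | 0, θ => ψ θ
  | n + 1, θ => ψ θ + max 0 (birkhoffMax γ ψ n (γ θ))

section Birkhoff

variable {Θ : Type*} {γ : Θ → Θ} {ψ : Θ → ℝ}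

theorem birkhoffMax_le_succ (n : ℕ) (θ : Θ) :
    birkhoffMax γ ψ n θ ≤ birkhoffMax γ ψ (n + 1) θ := by
  induction n generalizing θ with
  | zero => simp [birkhoffMax]
  | succ n ih =>
    rw [birkhoffMax, birkhoffMax]
    gcongr
    exact ih _

theorem monotone_birkhoffMax (θ : Θ) : Monotone fun n => birkhoffMax γ ψ n θ :=
  monotone_nat_of_le_succ fun n => birkhoffMax_le_succ n θ

theorem birkhoffSum_succ_le_birkhoffMax (n : ℕ) (θ : Θ) :
    birkhoffSum γ ψ (n + 1) θ ≤ birkhoffMax γ ψ n θ := by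
  induction n generalizing θ with
  | zero => simp [birkhoffMax]
  | succ n ih =>
    rw [birkhoffSum_succ', birkhoffMax]
    gcongr
    exact (ih _).trans (le_max_right _ _)

theorem bddAbove_birkhoffMax_comp_iff (θ : Θ) :
    BddAbove (range fun n => birkhoffMax γ ψ n (γ θ)) ↔
      BddAbove (range fun n => birkhoffMax γ ψ n θ) := by
  constructor
  · rintro ⟨K, hK⟩
    refine ⟨ψ θ + max 0 K, ?_⟩
    rintro _ ⟨n, rfl⟩
    refine (birkhoffMax_le_succ n θ).trans ?_
    rw [birkhoffMax]
    gcongr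
    exact hK ⟨n, rfl⟩
  · rintro ⟨K, hK⟩
    refine ⟨K - ψ θ, ?_⟩
    rintro _ ⟨n, rfl⟩
    have h1 : birkhoffMax γ ψ (n + 1) θ ≤ K := hK ⟨n + 1, rfl⟩
    rw [birkhoffMax] at h1
    have := le_max_right 0 (birkhoffMax γ ψ n (γ θ))
    simp only
    linarith

theorem abs_birkhoffMax_le {C : ℝ} (hC : ∀ θ, |ψ θ| ≤ C) (n : ℕ) (θ : Θ) :
    |birkhoffMax γ ψ n θ| ≤ (n + 1) * C := by
  induction n generalizing θ with
  | zero => simpa [birkhoffMax] using hC θ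
  | succ n ih =>
    have h1 := abs_le.1 (ih (γ θ))
    have h2 := abs_le.1 (hC θ)
    have h0 : 0 ≤ C := (abs_nonneg _).trans (hC θ)
    rw [birkhoffMax]
    push_cast
    have h3 : 0 ≤ ((n : ℝ) + 1) * C := by positivity
    rw [abs_le]
    constructor
    · linarith [le_max_left 0 (birkhoffMax γ ψ n (γ θ))]
    · linarith [max_le h3 h1.2]

variable [MeasurableSpace Θ] {m : Measure Θ}

theorem measurable_birkhoffMax (hγ : Measurable γ) (hψ : Measurable ψ) (n : ℕ) :
    Measurable (birkhoffMax γ ψ n) := by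
  induction n with
  | zero => exact hψ
  | succ n ih => exact hψ.add (measurable_const.max (ih.comp hγ))

/-- Birkhoff sums of a bounded function with negative mean over an ergodic map are almost surely
bounded above. -/
theorem ae_bddAbove_birkhoffMax [IsProbabilityMeasure m] (herg : Ergodic γ m)
    (hψ : Measurable ψ) {C : ℝ} (hC : ∀ θ, |ψ θ| ≤ C) (hneg : ∫ θ, ψ θ ∂m < 0) :
    ∀ᵐ θ ∂m, BddAbove (range fun n => birkhoffMax γ ψ n θ) := by
  have hM := measurable_birkhoffMax herg.measurable hψ
  have hD : MeasurableSet {θ | BddAbove (range fun n => birkhoffMax γ ψ n θ)} :=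
    measurableSet_bddAbove_range hM
  have hinv : γ ⁻¹' {θ | BddAbove (range fun n => birkhoffMax γ ψ n θ)} =
      {θ | BddAbove (range fun n => birkhoffMax γ ψ n θ)} :=
    Set.ext fun θ => bddAbove_birkhoffMax_comp_iff θ
  rcases herg.toPreErgodic.ae_empty_or_univ hD hinv with h0 | h1
  swap
  · filter_upwards [h1] with θ hθ
    exact hθ.mpr trivial
  exfalso
  have hint : ∀ n, Integrable (birkhoffMax γ ψ n) m := fun n =>
    Integrable.of_bound (hM n).aestronglyMeasurable ((n + 1) * C)
      (.of_forall fun θ => abs_birkhoffMax_le hC n θ)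
  have hψi : Integrable ψ m := hint 0
  have hge : ∀ n, 0 ≤ (∫ θ, ψ θ ∂m) + ∫ θ, max 0 (-birkhoffMax γ ψ n θ) ∂m := by
    intro n
    have hmp : ∀ f : Θ → ℝ, Measurable f → ∫ θ, f (γ θ) ∂m = ∫ θ, f θ ∂m := by
      intro f hf
      conv_rhs => rw [← herg.toMeasurePreserving.map_eq]
      rw [integral_map herg.measurable.aemeasurable hf.aestronglyMeasurable]
    have hmax : Integrable (fun θ => max 0 (-birkhoffMax γ ψ n θ)) m := by
      simpa [max_comm] using (hint n).neg.pos_part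
    have e1 : ∫ θ, birkhoffMax γ ψ n θ ∂m ≤ ∫ θ, birkhoffMax γ ψ (n + 1) θ ∂m :=
      integral_mono (hint n) (hint (n + 1)) fun θ => birkhoffMax_le_succ n θ
    have e2 : ∀ θ, birkhoffMax γ ψ (n + 1) θ =
        ψ θ + (max 0 (-birkhoffMax γ ψ n (γ θ)) + birkhoffMax γ ψ n (γ θ)) := by
      intro θ
      rw [birkhoffMax]
      rcases le_total 0 (birkhoffMax γ ψ n (γ θ)) with h | h
      · rw [max_eq_right h, max_eq_left (by linarith)]; ring
      · rw [max_eq_left h, max_eq_right (by linarith)]; ring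
    have i1 : Integrable (fun θ => max 0 (-birkhoffMax γ ψ n (γ θ))) m :=
      herg.toMeasurePreserving.integrable_comp_of_integrable hmax
    have i2 : Integrable (fun θ => birkhoffMax γ ψ n (γ θ)) m :=
      herg.toMeasurePreserving.integrable_comp_of_integrable (hint n)
    have e3 : ∫ θ, birkhoffMax γ ψ (n + 1) θ ∂m = (∫ θ, ψ θ ∂m) +
        ((∫ θ, max 0 (-birkhoffMax γ ψ n θ) ∂m) + ∫ θ, birkhoffMax γ ψ n θ ∂m) := by
      rw [← hmp (fun θ => max 0 (-birkhoffMax γ ψ n θ)) (measurable_const.max (hM n).neg), ← hmp _ (hM n),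
        ← integral_add i1 i2]
      refine (integral_congr_ae (.of_forall e2)).trans ?_
      exact integral_add hψi (i1.add i2)
    linarith
  have hlim : Tendsto (fun n => ∫ θ, max 0 (-birkhoffMax γ ψ n θ) ∂m) atTop
      (𝓝 (∫ _, (0 : ℝ) ∂m)) := by
    refine tendsto_integral_of_dominated_convergence (fun _ => C)
      (fun n => (measurable_const.max (hM n).neg).aestronglyMeasurable) (integrable_const C) ?_ ?_
    · intro n
      refine .of_forall fun θ => ?_
      rw [Real.norm_of_nonneg (le_max_left _ _)]
      refine max_le ((abs_nonneg _).trans (hC θ)) ?_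
      have h1 : ψ θ ≤ birkhoffMax γ ψ n θ := monotone_birkhoffMax θ (Nat.zero_le n)
      linarith [(abs_le.1 (hC θ)).1]
    · filter_upwards [h0] with θ hθ
      have hnb : ¬ BddAbove (range fun n => birkhoffMax γ ψ n θ) := fun hb => (hθ.mp hb).elim
      have ht := tendsto_atTop_atTop_of_monotone' (monotone_birkhoffMax θ) hnb
      refine tendsto_const_nhds.congr' ?_
      filter_upwards [ht.eventually_ge_atTop 0] with n hn
      rw [max_eq_left (by linarith)]
  have := ge_of_tendsto' (hlim.const_add (∫ θ, ψ θ ∂m)) hge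
  simp only [integral_zero, add_zero] at this
  linarith

/-- The upper half of Birkhoff's ergodic theorem for bounded functions. -/
theorem ae_exists_birkhoffSum_le [IsProbabilityMeasure m] (herg : Ergodic γ m)
    {φ : Θ → ℝ} (hφ : Measurable φ) {C : ℝ} (hC : ∀ θ, |φ θ| ≤ C) {c : ℝ}
    (hc : ∫ θ, φ θ ∂m < c) :
    ∀ᵐ θ ∂m, ∃ K, ∀ n : ℕ, birkhoffSum γ φ n θ ≤ K + c * n := by
  have hφi : Integrable φ m := Integrable.of_bound hφ.aestronglyMeasurable C (.of_forall hC)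
  have key := ae_bddAbove_birkhoffMax (ψ := fun θ => φ θ - c) herg (hφ.sub_const c)
    (C := C + |c|) (fun θ => (abs_sub _ _).trans (by gcongr; exact hC θ)) (by
      rw [integral_sub hφi (integrable_const c)]
      simpa using hc)
  filter_upwards [key] with θ ⟨K, hK⟩
  have hsum : ∀ n : ℕ, birkhoffSum γ (fun θ => φ θ - c) n θ = birkhoffSum γ φ n θ - c * n := by
    intro n
    simp [birkhoffSum, Finset.sum_sub_distrib, mul_comm]
  refine ⟨max 0 K, fun n => ?_⟩
  rcases n with _ | n
  · simp
  · have h1 := (birkhoffSum_succ_le_birkhoffMax n θ).trans (hK ⟨n, rfl⟩)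
    rw [hsum] at h1
    linarith [le_max_right 0 K]

end Birkhoff

theorem mulVecE_eq_toEuclideanCLM (M : Matrix (Fin 2) (Fin 2) ℝ) (v : R2) :
    mulVecE M v = (Matrix.toEuclideanCLM (𝕜 := ℝ) M : R2 →L[ℝ] R2) v := rfl

theorem norm_mulVecE_le (M : Matrix (Fin 2) (Fin 2) ℝ) (v : R2) :
    ‖mulVecE M v‖ ≤ opNorm M * ‖v‖ := by
  rw [mulVecE_eq_toEuclideanCLM]
  exact ContinuousLinearMap.le_opNorm _ _

theorem opNorm_nonneg (M : Matrix (Fin 2) (Fin 2) ℝ) : 0 ≤ opNorm M := norm_nonneg _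

theorem opNorm_mul_le (M N : Matrix (Fin 2) (Fin 2) ℝ) :
    opNorm (M * N) ≤ opNorm M * opNorm N := by
  unfold opNorm
  rw [map_mul]
  exact norm_mul_le _ _

theorem mulVecE_smul (M : Matrix (Fin 2) (Fin 2) ℝ) (c : ℝ) (v : R2) :
    mulVecE M (c • v) = c • mulVecE M v := by
  simp only [mulVecE_eq_toEuclideanCLM, map_smul]

theorem mulVecE_mul (M N : Matrix (Fin 2) (Fin 2) ℝ) (v : R2) :
    mulVecE (M * N) v = mulVecE M (mulVecE N v) := by
  simp only [mulVecE_eq_toEuclideanCLM, map_mul, mul_apply_eq_comp]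

theorem mulVecE_one (v : R2) : mulVecE 1 v = v := by
  simp only [mulVecE_eq_toEuclideanCLM, map_one, one_apply_eq_self]

theorem mulVecE_zero (M : Matrix (Fin 2) (Fin 2) ℝ) : mulVecE M 0 = 0 := by
  simp only [mulVecE_eq_toEuclideanCLM, map_zero]

theorem continuous_mulVecE (M : Matrix (Fin 2) (Fin 2) ℝ) : Continuous (mulVecE M) :=
  (Matrix.toEuclideanCLM (𝕜 := ℝ) M : R2 →L[ℝ] R2).continuous

theorem mulVecE_apply (M : Matrix (Fin 2) (Fin 2) ℝ) (v : R2) (i : Fin 2) :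
    mulVecE M v i = M i 0 * v 0 + M i 1 * v 1 := by
  fin_cases i <;> simp [mulVecE]

theorem mulVecE_injective {M : Matrix (Fin 2) (Fin 2) ℝ} (hM : M.det = 1) :
    Function.Injective (mulVecE M) := by
  intro v w hvw
  have hu : IsUnit M.det := by rw [hM]; exact isUnit_one
  rw [← mulVecE_one v, ← mulVecE_one w, ← Matrix.nonsing_inv_mul M hu, mulVecE_mul, mulVecE_mul,
    hvw]

/-- The signed area spanned by two plane vectors. -/
def wedge (v w : R2) : ℝ := v 0 * w 1 - v 1 * w 0

theorem wedge_smul_smul (a b : ℝ) (v w : R2) : wedge (a • v) (b • w) = a * b * wedge v w := by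
  simp only [wedge, PiLp.smul_apply, smul_eq_mul]
  ring

theorem wedge_mulVecE (M : Matrix (Fin 2) (Fin 2) ℝ) (v w : R2) :
    wedge (mulVecE M v) (mulVecE M w) = M.det * wedge v w := by
  simp only [wedge, mulVecE_apply, Matrix.det_fin_two]
  ring

theorem norm_sq_R2 (v : R2) : ‖v‖ ^ 2 = v 0 ^ 2 + v 1 ^ 2 := by
  simp [EuclideanSpace.norm_sq_eq, Fin.sum_univ_two]

theorem abs_wedge_le (v w : R2) : |wedge v w| ≤ ‖v‖ * ‖w‖ := by
  refine abs_le_of_sq_le_sq ?_ (by positivity)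
  rw [mul_pow, norm_sq_R2, norm_sq_R2, wedge]
  nlinarith [sq_nonneg (v 0 * w 0 + v 1 * w 1)]

theorem exists_eq_smul_of_wedge_eq_zero {x z : R2} (hx : x ≠ 0) (hzx : wedge z x = 0) :
    ∃ t : ℝ, z = t • x := by
  rw [wedge, sub_eq_zero] at hzx
  by_cases h0 : x 0 = 0
  · have h1 : x 1 ≠ 0 := by
      intro h1
      apply hx
      ext i
      fin_cases i <;> simpa
    refine ⟨z 1 / x 1, ?_⟩
    ext i
    fin_cases i
    · rw [h0, mul_zero] at hzx
      simpa [h0, h1] using hzx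
    · simp [h1]
  · refine ⟨z 0 / x 0, ?_⟩
    ext i
    fin_cases i
    · simp [h0]
    · simp only [Fin.mk_one, PiLp.smul_apply, smul_eq_mul]
      field_simp
      linarith

theorem one_le_opNorm {M : Matrix (Fin 2) (Fin 2) ℝ} (hM : M.det = 1) : 1 ≤ opNorm M := by
  have hb : ∀ i : Fin 2, ‖mulVecE M (EuclideanSpace.single i 1)‖ ≤ opNorm M := fun i => by
    simpa using norm_mulVecE_le M (EuclideanSpace.single i 1)
  have h1 : wedge (mulVecE M (EuclideanSpace.single 0 1)) (mulVecE M (EuclideanSpace.single 1 1))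
      = 1 := by
    rw [wedge_mulVecE, hM]
    simp [wedge]
  have h2 := abs_wedge_le (mulVecE M (EuclideanSpace.single 0 1))
    (mulVecE M (EuclideanSpace.single 1 1))
  rw [h1, abs_one] at h2
  have h3 : 1 ≤ opNorm M * opNorm M := h2.trans
    (mul_le_mul (hb 0) (hb 1) (norm_nonneg _) (opNorm_nonneg _))
  nlinarith [opNorm_nonneg M]

theorem continuous_opNorm : Continuous opNorm := by
  unfold opNorm
  refine continuous_norm.comp ?_
  exact LinearMap.continuous_of_finiteDimensional
    ((Matrix.toEuclideanCLM (n := Fin 2) (𝕜 := ℝ)).toAlgEquiv.toLinearMap)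

section Gain

variable {h : ℝ → ℝ}

theorem GoodH.continuousOn (hh : GoodH h) : ContinuousOn h (Ici 0) := hh.1.continuousOn

theorem GoodH.nonneg (hh : GoodH h) {x : ℝ} (hx : 0 ≤ x) : 0 ≤ h x := hh.2.2.2.2.1 x hx

theorem GoodH.map_zero (hh : GoodH h) : h 0 = 0 := hh.2.2.2.2.2.1

theorem GoodH.strictMonoOn (hh : GoodH h) : StrictMonoOn h (Ici 0) := hh.2.1

theorem GoodH.pos (hh : GoodH h) {x : ℝ} (hx : 0 < x) : 0 < h x := by
  have := hh.strictMonoOn (mem_Ici.2 le_rfl) (mem_Ici.2 hx.le) hx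
  rwa [hh.map_zero] at this

theorem GoodH.le_self (hh : GoodH h) {x : ℝ} (hx : 0 ≤ x) : h x ≤ x := by
  rcases hx.eq_or_lt with rfl | hx
  · exact hh.map_zero.le
  have hd : HasDerivWithinAt h 1 (Ici 0) 0 := by
    have := ((hh.1.differentiableOn (by norm_num)) 0 (mem_Ici.2 le_rfl)).hasDerivWithinAt
    rwa [hh.2.2.2.2.2.2] at this
  have hs := hh.2.2.1.concaveOn.slope_le_of_hasDerivWithinAt (mem_Ici.2 le_rfl)
    (mem_Ici.2 hx.le) hx hd
  rw [slope_def_field, hh.map_zero, sub_zero, sub_zero, div_le_one hx] at hs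
  exact hs

theorem GoodH.exists_le_mul (hh : GoodH h) {a : ℝ} (ha : 0 < a) :
    ∃ q, 0 < q ∧ q < 1 ∧ ∀ x, a ≤ x → h x ≤ q * x := by
  refine ⟨h a / a, div_pos (hh.pos ha) ha, ?_, fun x hx => ?_⟩
  · have hs := hh.2.2.1.2 (mem_Ici.2 le_rfl) (mem_Ici.2 ha.le) ha.ne
      (show (0 : ℝ) < 1 / 2 by norm_num) (show (0 : ℝ) < 1 / 2 by norm_num) (by norm_num)
    simp only [smul_eq_mul, hh.map_zero, mul_zero, zero_add] at hs
    have := hh.le_self (show 0 ≤ 1 / 2 * a by positivity)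
    rw [div_lt_one ha]
    linarith
  · have hx0 : 0 < x := ha.trans_le hx
    have hs := hh.2.2.1.concaveOn.2 (mem_Ici.2 le_rfl) (mem_Ici.2 hx0.le)
      (show 0 ≤ 1 - a / x by rw [sub_nonneg, div_le_one hx0]; exact hx)
      (show 0 ≤ a / x by positivity) (by ring)
    simp only [smul_eq_mul, hh.map_zero, mul_zero, zero_add] at hs
    rw [div_mul_cancel₀ _ hx0.ne'] at hs
    rw [div_mul_eq_mul_div, le_div_iff₀ ha]
    rw [div_mul_eq_mul_div, div_le_iff₀ hx0] at hs
    linarith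

end Gain

section FibreMap

variable {Θ : Type*} {A : Θ → Matrix (Fin 2) (Fin 2) ℝ} {h : ℝ → ℝ} {β : ℝ}

theorem fibMap_eq_smul (θ : Θ) (v : R2) :
    fibMap A h β θ v = (h (β * ‖v‖) / ‖v‖) • mulVecE (A θ) v := by
  unfold fibMap
  split_ifs with hv
  · simp [hv]
  · rfl

theorem fibMap_zero (θ : Θ) : fibMap A h β θ 0 = 0 := by simp [fibMap]

theorem norm_fibMap (hh : GoodH h) (hβ : 0 < β) (θ : Θ) (v : R2) :
    ‖fibMap A h β θ v‖ = h (β * ‖v‖) / ‖v‖ * ‖mulVecE (A θ) v‖ := by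
  rw [fibMap_eq_smul, norm_smul, Real.norm_of_nonneg]
  exact div_nonneg (hh.nonneg (by positivity)) (norm_nonneg _)

theorem gain_le (hh : GoodH h) (hβ : 0 < β) (r : ℝ) (hr : 0 ≤ r) : h (β * r) / r ≤ β := by
  rcases hr.eq_or_lt with rfl | hr
  · simpa using hβ.le
  · rw [div_le_iff₀ hr]
    exact hh.le_self (by positivity)

theorem norm_fibMap_le_one (hA : ∃ C : ℝ, ∀ θ, opNorm (A θ) ≤ C) (hdet : ∀ θ, (A θ).det = 1)
    (hh : GoodH h) (hscale : Scaled A h) (hβ : 0 < β) (θ : Θ) (v : R2) :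
    ‖fibMap A h β θ v‖ ≤ 1 := by
  by_cases hv : v = 0
  · simp [hv, fibMap_zero]
  have hv' : 0 < ‖v‖ := norm_pos_iff.2 hv
  obtain ⟨C, hC⟩ := hA
  have hle : opNorm (A θ) ≤ ⨆ θ, opNorm (A θ) :=
    le_ciSup (f := fun θ => opNorm (A θ)) ⟨C, by rintro _ ⟨θ, rfl⟩; exact hC θ⟩ θ
  have hpos : 0 < ⨆ θ, opNorm (A θ) := (zero_lt_one.trans_le (one_le_opNorm (hdet θ))).trans_le hle
  have hs := hscale (β * ‖v‖) (mem_Ici.2 (by positivity))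
  have h0 : 0 ≤ h (β * ‖v‖) := hh.nonneg (by positivity)
  rw [norm_fibMap hh hβ]
  calc h (β * ‖v‖) / ‖v‖ * ‖mulVecE (A θ) v‖
      ≤ h (β * ‖v‖) / ‖v‖ * (opNorm (A θ) * ‖v‖) := by
        gcongr
        exact norm_mulVecE_le _ _
    _ = h (β * ‖v‖) * opNorm (A θ) := by field_simp
    _ ≤ (⨆ θ, opNorm (A θ))⁻¹ * ⨆ θ, opNorm (A θ) := by
        gcongr
        exact opNorm_nonneg _
    _ = 1 := inv_mul_cancel₀ hpos.ne'

theorem fibMap_injective (hdet : ∀ θ, (A θ).det = 1) (hh : GoodH h) (hβ : 0 < β) (θ : Θ) :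
    Function.Injective (fibMap A h β θ) := by
  have hnorm : ∀ v : R2, ‖(h (β * ‖v‖) / ‖v‖) • v‖ = h (β * ‖v‖) := by
    intro v
    rw [norm_smul, Real.norm_of_nonneg
      (div_nonneg (hh.nonneg (by positivity)) (norm_nonneg _))]
    by_cases hv : ‖v‖ = 0
    · simp [hv, hh.map_zero]
    · field_simp
  intro v w hvw
  rw [fibMap_eq_smul, fibMap_eq_smul, ← mulVecE_smul, ← mulVecE_smul] at hvw
  have hvw' := mulVecE_injective (hdet θ) hvw
  have hn : h (β * ‖v‖) = h (β * ‖w‖) := by rw [← hnorm v, ← hnorm w, hvw']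
  have hn' : ‖v‖ = ‖w‖ := mul_left_cancel₀ hβ.ne'
    (hh.strictMonoOn.injOn (mem_Ici.2 (by positivity)) (mem_Ici.2 (by positivity)) hn)
  by_cases hw : w = 0
  · rw [hw] at hn' ⊢
    simpa using hn'
  · have hw' : 0 < ‖w‖ := norm_pos_iff.2 hw
    rw [hn'] at hvw'
    exact smul_right_injective R2 (div_pos (hh.pos (by positivity)) hw').ne' hvw'

theorem continuous_fibMap (hh : GoodH h) (hβ : 0 < β) (θ : Θ) :
    Continuous (fibMap A h β θ) := by
  rw [continuous_iff_continuousAt]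
  intro v
  by_cases hv : v = 0
  · subst hv
    rw [ContinuousAt, fibMap_zero, tendsto_zero_iff_norm_tendsto_zero]
    refine squeeze_zero (g := fun v => β * ‖mulVecE (A θ) v‖) (fun _ => norm_nonneg _)
      (fun v => ?_) ?_
    · rw [norm_fibMap hh hβ]
      gcongr
      exact gain_le hh hβ _ (norm_nonneg _)
    · have : Continuous fun v => β * ‖mulVecE (A θ) v‖ :=
        continuous_const.mul (continuous_mulVecE _).norm
      simpa [mulVecE_zero] using this.tendsto 0
  · have hv' : 0 < ‖v‖ := norm_pos_iff.2 hv
    rw [show fibMap A h β θ = fun v => (h (β * ‖v‖) / ‖v‖) • mulVecE (A θ) v from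
      funext (fibMap_eq_smul θ)]
    refine ContinuousAt.smul (ContinuousAt.div ?_ continuous_norm.continuousAt hv'.ne')
      (continuous_mulVecE _).continuousAt
    have h1 : ContinuousAt h (β * ‖v‖) :=
      hh.continuousOn.continuousAt (Ici_mem_nhds (by positivity))
    exact ContinuousAt.comp (f := fun v : R2 => β * ‖v‖) h1 (by fun_prop)

theorem abs_wedge_fibMap_le (hdet : ∀ θ, (A θ).det = 1) (hh : GoodH h) (hβ : 0 < β) (θ : Θ)
    (v w : R2) :
    |wedge (fibMap A h β θ v) (fibMap A h β θ w)| ≤ β * β * |wedge v w| := by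
  rw [fibMap_eq_smul, fibMap_eq_smul, wedge_smul_smul, wedge_mulVecE, hdet, one_mul, abs_mul]
  gcongr
  have h0 : ∀ v : R2, 0 ≤ h (β * ‖v‖) / ‖v‖ := fun v =>
    div_nonneg (hh.nonneg (by positivity)) (norm_nonneg _)
  rw [abs_mul, abs_of_nonneg (h0 v), abs_of_nonneg (h0 w)]
  exact mul_le_mul (gain_le hh hβ _ (norm_nonneg _)) (gain_le hh hβ _ (norm_nonneg _)) (h0 w) hβ.le

theorem norm_fibMap_le_of_wedge_eq_zero (hh : GoodH h) (hβ : 0 < β) (θ : Θ) {x z : R2}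
    (hzx : wedge z x = 0) (hle : ‖z‖ ≤ ‖x‖) : ‖fibMap A h β θ z‖ ≤ ‖fibMap A h β θ x‖ := by
  by_cases hz : z = 0
  · simp [hz, fibMap_zero]
  have hz' : 0 < ‖z‖ := norm_pos_iff.2 hz
  have hx' : 0 < ‖x‖ := hz'.trans_le hle
  obtain ⟨t, rfl⟩ := exists_eq_smul_of_wedge_eq_zero (norm_pos_iff.1 hx') hzx
  rw [norm_fibMap hh hβ, norm_fibMap hh hβ, mulVecE_smul, norm_smul t (mulVecE _ _)]
  have ht : ‖t‖ ≠ 0 := by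
    rw [norm_smul] at hz'
    exact (pos_of_mul_pos_left hz' (norm_nonneg _)).ne'
  calc h (β * ‖t • x‖) / ‖t • x‖ * (‖t‖ * ‖mulVecE (A θ) x‖)
      = h (β * ‖t • x‖) / ‖x‖ * ‖mulVecE (A θ) x‖ := by
        rw [norm_smul]
        field_simp
    _ ≤ h (β * ‖x‖) / ‖x‖ * ‖mulVecE (A θ) x‖ := by
        gcongr
        exact hh.strictMonoOn.monotoneOn (mem_Ici.2 (by positivity)) (mem_Ici.2 (by positivity))
          (by gcongr)

end FibreMap

/-- The fibre component `f^n_{β,θ}(v)` of the iterated skew product. -/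
def iterFib {Θ : Type*} (γ : Θ → Θ) (A : Θ → Matrix (Fin 2) (Fin 2) ℝ) (h : ℝ → ℝ) (β : ℝ)
    (n : ℕ) (θ : Θ) (v : R2) : R2 :=
  ((skewProd γ A h β)^[n] (θ, v)).2

section Orbit

variable {Θ : Type*} {γ : Θ → Θ} {A : Θ → Matrix (Fin 2) (Fin 2) ℝ} {h : ℝ → ℝ} {β : ℝ}

theorem skewProd_iterate (n : ℕ) (θ : Θ) (v : R2) :
    (skewProd γ A h β)^[n] (θ, v) = (γ^[n] θ, iterFib γ A h β n θ v) := by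
  refine Prod.ext ?_ rfl
  induction n with
  | zero => rfl
  | succ n ih => rw [Function.iterate_succ_apply', Function.iterate_succ_apply']; exact congrArg γ ih

theorem iterFib_zero (θ : Θ) (v : R2) : iterFib γ A h β 0 θ v = v := rfl

theorem iterFib_succ (n : ℕ) (θ : Θ) (v : R2) :
    iterFib γ A h β (n + 1) θ v = fibMap A h β (γ^[n] θ) (iterFib γ A h β n θ v) := by
  rw [iterFib, Function.iterate_succ_apply', skewProd_iterate]
  rfl

theorem iterFib_add (m n : ℕ) (θ : Θ) (v : R2) :
    iterFib γ A h β (m + n) θ v = iterFib γ A h β m (γ^[n] θ) (iterFib γ A h β n θ v) := by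
  rw [iterFib, Function.iterate_add_apply, skewProd_iterate n]
  rfl

theorem iterFib_succ' (n : ℕ) (θ : Θ) (v : R2) :
    iterFib γ A h β (n + 1) θ v = iterFib γ A h β n (γ θ) (fibMap A h β θ v) := by
  rw [iterFib_add]
  rfl

theorem iterFib_apply_zero (n : ℕ) (θ : Θ) : iterFib γ A h β n θ 0 = 0 := by
  induction n with
  | zero => rfl
  | succ n ih => rw [iterFib_succ, ih, fibMap_zero]

theorem continuous_iterFib (hh : GoodH h) (hβ : 0 < β) (n : ℕ) (θ : Θ) :
    Continuous (iterFib γ A h β n θ) := by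
  induction n with
  | zero => exact continuous_id
  | succ n ih =>
    rw [show iterFib γ A h β (n + 1) θ = fun v => _ from funext (iterFib_succ n θ)]
    exact (continuous_fibMap hh hβ _).comp ih

theorem norm_iterFib_le_one (hA : ∃ C : ℝ, ∀ θ, opNorm (A θ) ≤ C) (hdet : ∀ θ, (A θ).det = 1)
    (hh : GoodH h) (hscale : Scaled A h) (hβ : 0 < β) (n : ℕ) (θ : Θ) {v : R2} (hv : ‖v‖ ≤ 1) :
    ‖iterFib γ A h β n θ v‖ ≤ 1 := by
  rcases n with _ | n
  · exact hv
  · rw [iterFib_succ]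
    exact norm_fibMap_le_one hA hdet hh hscale hβ _ _

theorem abs_wedge_iterFib_le (hdet : ∀ θ, (A θ).det = 1) (hh : GoodH h) (hβ : 0 < β) (n : ℕ)
    (θ : Θ) (v w : R2) :
    |wedge (iterFib γ A h β n θ v) (iterFib γ A h β n θ w)| ≤ (β * β) ^ n * |wedge v w| := by
  induction n with
  | zero => simp [iterFib_zero]
  | succ n ih =>
    rw [iterFib_succ, iterFib_succ, pow_succ', mul_assoc]
    refine (abs_wedge_fibMap_le hdet hh hβ _ _ _).trans ?_
    gcongr

theorem coc_add (m n : ℕ) (θ : Θ) : coc γ A (m + n) θ = coc γ A m (γ^[n] θ) * coc γ A n θ := by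
  induction n generalizing θ with
  | zero => simp [coc]
  | succ n ih => rw [← add_assoc, coc, coc, ih, Function.iterate_succ_apply, mul_assoc]

theorem coc_one (θ : Θ) : coc γ A 1 θ = A θ := by simp [coc]

theorem det_coc (hdet : ∀ θ, (A θ).det = 1) (n : ℕ) (θ : Θ) : (coc γ A n θ).det = 1 := by
  induction n generalizing θ with
  | zero => simp [coc]
  | succ n ih => rw [coc, Matrix.det_mul, ih, hdet, one_mul]

theorem norm_iterFib_le (hh : GoodH h) (hβ : 0 < β) {q δ : ℝ} (hq0 : 0 < q)
    (hδ : 0 < δ) (hq : ∀ x, β * δ ≤ x → h x ≤ q * x) (n : ℕ) (θ : Θ) {v : R2} (hv : ‖v‖ ≤ 1) :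
    ‖iterFib γ A h β n θ v‖ ≤
      β ^ n * q ^ ((Finset.range n).filter fun i => δ ≤ ‖iterFib γ A h β i θ v‖).card *
        opNorm (coc γ A n θ) := by
  suffices H : ∃ c : ℝ, 0 ≤ c ∧
      c ≤ β ^ n * q ^ ((Finset.range n).filter fun i => δ ≤ ‖iterFib γ A h β i θ v‖).card ∧
      iterFib γ A h β n θ v = c • mulVecE (coc γ A n θ) v by
    obtain ⟨c, hc0, hc, he⟩ := H
    rw [he, norm_smul, Real.norm_of_nonneg hc0]
    refine mul_le_mul hc ?_ (norm_nonneg _) (by positivity)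
    refine (norm_mulVecE_le _ _).trans (mul_le_of_le_one_right (opNorm_nonneg _) hv)
  induction n with
  | zero => exact ⟨1, by simp, by simp, by simp [iterFib_zero, coc, mulVecE_one]⟩
  | succ n ih =>
    obtain ⟨c, hc0, hc, he⟩ := ih
    set r := ‖iterFib γ A h β n θ v‖ with hr
    have hr0 : 0 ≤ r := norm_nonneg _
    have hg0 : 0 ≤ h (β * r) / r := div_nonneg (hh.nonneg (by positivity)) hr0
    refine ⟨h (β * r) / r * c, by positivity, ?_, ?_⟩
    · rw [Finset.range_add_one, Finset.filter_insert]
      split_ifs with hd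
      · rw [Finset.card_insert_of_notMem (by simp), pow_succ', pow_succ']
        have : h (β * r) / r ≤ q * β := by
          rw [div_le_iff₀ (hδ.trans_le hd), mul_assoc]
          exact hq _ (by gcongr)
        calc h (β * r) / r * c ≤ q * β * _ := mul_le_mul this hc hc0 (by positivity)
          _ = _ := by ring
      · rw [pow_succ', mul_assoc]
        exact mul_le_mul (gain_le hh hβ _ hr0) hc hc0 hβ.le
    · rw [iterFib_succ, fibMap_eq_smul, ← hr, he, mulVecE_smul, smul_smul, ← mulVecE_mul,
        add_comm n 1, coc_add, coc_one]

/-- If the norms of the cocycle grow at rate at most `-log β` along the orbit of `θ`, the visits of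
fibre orbits to `{‖v‖ ≥ δ}` are sparse, uniformly in the initial vector. -/
theorem exists_card_visits_le (hdet : ∀ θ, (A θ).det = 1) (hh : GoodH h) {lam : ℝ}
    (hβ : β = Real.exp (-lam)) {δ : ℝ} (hδ : 0 < δ) {θ : Θ}
    (hθ : ∀ ε > 0, ∃ K, ∀ n : ℕ, Real.log (opNorm (coc γ A n θ)) ≤ K + (lam + ε) * n)
    {ε : ℝ} (hε : 0 < ε) :
    ∃ K, ∀ v : R2, ‖v‖ ≤ 1 → ∀ n : ℕ,
      (((Finset.range n).filter fun i => δ ≤ ‖iterFib γ A h β i θ v‖).card : ℝ) ≤ K + ε * n := by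
  have hβ0 : 0 < β := hβ ▸ Real.exp_pos _
  obtain ⟨q, hq0, hq1, hq⟩ := hh.exists_le_mul (mul_pos hβ0 hδ)
  have hlβ : Real.log β = -lam := by rw [hβ, Real.log_exp]
  have hl : 0 < -Real.log q := neg_pos.2 (Real.log_neg hq0 hq1)
  obtain ⟨K, hK⟩ := hθ (ε * -Real.log q) (by positivity)
  set L := max 0 ((K - Real.log δ) / -Real.log q) with hL
  refine ⟨L + 1, fun v hv n => ?_⟩
  induction n with
  | zero =>
    have : 0 ≤ L := le_max_left _ _
    simp only [Finset.range_zero, Finset.filter_empty, Finset.card_empty, Nat.cast_zero, mul_zero]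
    linarith
  | succ n ih =>
    rw [Finset.range_add_one, Finset.filter_insert]
    push_cast
    split_ifs with hd
    · rw [Finset.card_insert_of_notMem (by simp)]
      set k := ((Finset.range n).filter fun i => δ ≤ ‖iterFib γ A h β i θ v‖).card
      have h1 := hd.trans (norm_iterFib_le hh hβ0 hq0 hδ hq n θ hv)
      have hop : 0 < opNorm (coc γ A n θ) := zero_lt_one.trans_le (one_le_opNorm (det_coc hdet n θ))
      have h2 := Real.log_le_log hδ h1
      rw [Real.log_mul (by positivity) hop.ne', Real.log_mul (by positivity) (by positivity),
        Real.log_pow, Real.log_pow, hlβ] at h2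
      have h3 := hK n
      have h4 : (K - Real.log δ) / -Real.log q ≤ L := le_max_right _ _
      rw [div_le_iff₀ hl] at h4
      have h5 : (k : ℝ) * -Real.log q ≤ (L + ε * n) * -Real.log q := by linarith
      have h6 := le_of_mul_le_mul_right h5 hl
      push_cast
      linarith
    · linarith

end Orbit

/-- The fibre over `θ` of the image of the unit ball bundle under the `n`-th iterate. -/
def pullbackBall {Θ : Type*} (γ : Θ ≃ Θ) (A : Θ → Matrix (Fin 2) (Fin 2) ℝ) (h : ℝ → ℝ) (β : ℝ)
    (n : ℕ) (θ : Θ) : Set R2 :=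
  iterFib γ A h β n (γ.symm^[n] θ) '' closedBall 0 1

section Attractor

variable {Θ : Type*} {γ : Θ ≃ Θ} {A : Θ → Matrix (Fin 2) (Fin 2) ℝ} {h : ℝ → ℝ} {β : ℝ}

theorem iterate_apply_symm_iterate (n : ℕ) (θ : Θ) : γ^[n] (γ.symm^[n] θ) = θ :=
  (Function.RightInverse.iterate γ.apply_symm_apply n) θ

theorem symm_iterate_apply_iterate (n : ℕ) (θ : Θ) : γ.symm^[n] (γ^[n] θ) = θ :=
  (Function.RightInverse.iterate γ.symm_apply_apply n) θ

theorem attractorFib_eq_iInter (θ : Θ) :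
    attractorFib γ A h β θ = ⋂ n, pullbackBall γ A h β n θ := by
  ext x
  simp only [attractorFib, globalAttractor, pullbackBall, mem_iInter, mem_ofPred_eq]
  refine forall_congr' fun n => ?_
  constructor
  · rintro ⟨⟨θ', v⟩, ⟨-, hv⟩, he⟩
    rw [skewProd_iterate, Prod.mk.injEq] at he
    refine ⟨v, hv, ?_⟩
    rw [← he.1, symm_iterate_apply_iterate, he.2]
  · rintro ⟨v, hv, he⟩
    refine ⟨(γ.symm^[n] θ, v), ⟨mem_univ _, hv⟩, ?_⟩
    rw [skewProd_iterate, iterate_apply_symm_iterate, he]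

theorem pullbackBall_succ_apply (n : ℕ) (θ : Θ) :
    pullbackBall γ A h β (n + 1) (γ θ) = fibMap A h β θ '' pullbackBall γ A h β n θ := by
  rw [pullbackBall, pullbackBall, Function.iterate_succ_apply, γ.symm_apply_apply, image_image]
  refine image_congr fun v _ => ?_
  rw [iterFib_succ, iterate_apply_symm_iterate]

theorem iterFib_mem_pullbackBall (n : ℕ) (θ : Θ) {v : R2} (hv : ‖v‖ ≤ 1) :
    iterFib γ A h β n θ v ∈ pullbackBall γ A h β n (γ^[n] θ) := by
  refine ⟨v, by simpa using hv, ?_⟩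
  rw [symm_iterate_apply_iterate]

theorem isCompact_pullbackBall (hh : GoodH h) (hβ : 0 < β) (n : ℕ) (θ : Θ) :
    IsCompact (pullbackBall γ A h β n θ) :=
  (isCompact_closedBall _ _).image (continuous_iterFib hh hβ _ _)

theorem zero_mem_pullbackBall (n : ℕ) (θ : Θ) : 0 ∈ pullbackBall γ A h β n θ :=
  ⟨0, by simp, iterFib_apply_zero _ _⟩

theorem zero_mem_attractorFib (θ : Θ) : 0 ∈ attractorFib γ A h β θ := by
  rw [attractorFib_eq_iInter, mem_iInter]
  exact fun n => zero_mem_pullbackBall n θ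

theorem antitone_pullbackBall (hA : ∃ C : ℝ, ∀ θ, opNorm (A θ) ≤ C) (hdet : ∀ θ, (A θ).det = 1)
    (hh : GoodH h) (hscale : Scaled A h) (hβ : 0 < β) (θ : Θ) :
    Antitone fun n => pullbackBall γ A h β n θ := by
  refine antitone_nat_of_succ_le fun n => ?_
  rintro _ ⟨v, -, rfl⟩
  refine ⟨fibMap A h β (γ.symm^[n + 1] θ) v, ?_, ?_⟩
  · exact mem_closedBall_zero_iff.2 (norm_fibMap_le_one hA hdet hh hscale hβ _ v)
  · rw [iterFib_succ', Function.iterate_succ_apply', γ.apply_symm_apply]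

theorem fibMap_mem_attractorFib (hA : ∃ C : ℝ, ∀ θ, opNorm (A θ) ≤ C)
    (hdet : ∀ θ, (A θ).det = 1) (hh : GoodH h) (hscale : Scaled A h) (hβ : 0 < β) {θ : Θ} {x : R2}
    (hx : x ∈ attractorFib γ A h β θ) : fibMap A h β θ x ∈ attractorFib γ A h β (γ θ) := by
  rw [attractorFib_eq_iInter, mem_iInter] at hx ⊢
  rintro (_ | n)
  · exact ⟨_, mem_closedBall_zero_iff.2 (norm_fibMap_le_one hA hdet hh hscale hβ θ x), rfl⟩
  · rw [pullbackBall_succ_apply]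
    exact mem_image_of_mem _ (hx n)

theorem exists_fibMap_eq_of_mem_attractorFib (hdet : ∀ θ, (A θ).det = 1) (hh : GoodH h)
    (hβ : 0 < β) {θ : Θ} {y : R2} (hy : y ∈ attractorFib γ A h β (γ θ)) :
    ∃ x ∈ attractorFib γ A h β θ, fibMap A h β θ x = y := by
  simp only [attractorFib_eq_iInter, mem_iInter] at hy ⊢
  have hy' : ∀ n, ∃ x ∈ pullbackBall γ A h β n θ, fibMap A h β θ x = y := fun n => by
    have := hy (n + 1)
    rwa [pullbackBall_succ_apply] at this
  choose x hx hxy using hy'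
  refine ⟨x 0, fun n => ?_, hxy 0⟩
  rw [fibMap_injective hdet hh hβ θ ((hxy 0).trans (hxy n).symm)]
  exact hx n

theorem wedge_eq_zero_of_mem_attractorFib (hdet : ∀ θ, (A θ).det = 1) (hh : GoodH h)
    (hβ : 0 < β) (hβ1 : β < 1) {θ : Θ} {x y : R2} (hx : x ∈ attractorFib γ A h β θ)
    (hy : y ∈ attractorFib γ A h β θ) : wedge x y = 0 := by
  rw [attractorFib_eq_iInter, mem_iInter] at hx hy
  have hle : ∀ n : ℕ, |wedge x y| ≤ (β * β) ^ n := by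
    intro n
    obtain ⟨v, hv, rfl⟩ := hx n
    obtain ⟨w, hw, rfl⟩ := hy n
    refine (abs_wedge_iterFib_le hdet hh hβ n _ v w).trans
      (mul_le_of_le_one_right (by positivity) ?_)
    rw [mem_closedBall_zero_iff] at hv hw
    exact (abs_wedge_le v w).trans (mul_le_one₀ hv (norm_nonneg _) hw)
  have := ge_of_tendsto' (tendsto_pow_atTop_nhds_zero_of_lt_one (by positivity)
    (mul_lt_one_of_nonneg_of_lt_one_left hβ.le hβ1 hβ1.le)) hle
  exact abs_nonpos_iff.1 this

theorem exists_isMaxOn_attractorFib (hh : GoodH h) (hβ : 0 < β) (θ : Θ) :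
    ∃ x ∈ attractorFib γ A h β θ, IsMaxOn norm (attractorFib γ A h β θ) x := by
  refine IsCompact.exists_isMaxOn ?_ ⟨0, zero_mem_attractorFib θ⟩ continuous_norm.continuousOn
  rw [attractorFib_eq_iInter]
  exact (isCompact_pullbackBall hh hβ 0 θ).of_isClosed_subset
    (isClosed_iInter fun n => (isCompact_pullbackBall hh hβ n θ).isClosed) (iInter_subset _ 0)

/-- The iterates of a vector of maximal norm in an attractor fibre have maximal norm. -/
theorem isMaxOn_iterFib (hA : ∃ C : ℝ, ∀ θ, opNorm (A θ) ≤ C)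
    (hdet : ∀ θ, (A θ).det = 1) (hh : GoodH h) (hscale : Scaled A h) (hβ : 0 < β) (hβ1 : β < 1)
    {θ : Θ} {x : R2} (hx : x ∈ attractorFib γ A h β θ)
    (hmax : IsMaxOn norm (attractorFib γ A h β θ) x) (n : ℕ) :
    iterFib γ A h β n θ x ∈ attractorFib γ A h β (γ^[n] θ) ∧
      IsMaxOn norm (attractorFib γ A h β (γ^[n] θ)) (iterFib γ A h β n θ x) := by
  induction n with
  | zero => exact ⟨hx, hmax⟩
  | succ n ih =>
    rw [iterFib_succ, Function.iterate_succ_apply']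
    refine ⟨fibMap_mem_attractorFib hA hdet hh hscale hβ ih.1, fun y hy => ?_⟩
    obtain ⟨z, hz, rfl⟩ := exists_fibMap_eq_of_mem_attractorFib hdet hh hβ hy
    exact norm_fibMap_le_of_wedge_eq_zero hh hβ _
      (wedge_eq_zero_of_mem_attractorFib hdet hh hβ hβ1 hz ih.1) (ih.2 hz)

end Attractor

/-- A nonnegative sequence with vanishing Cesàro means tends to zero off a set of density zero. -/
theorem exists_density_zero_tendsto_zero {T : ℕ → ℝ} (hT0 : ∀ n, 0 ≤ T n)
    (hT : ∀ ε > 0, ∃ K, ∀ n : ℕ, ∑ i ∈ Finset.range n, T i ≤ K + ε * n) :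
    ∃ J : Set ℕ,
      Tendsto (fun n : ℕ => (∑ i ∈ Finset.range n, J.indicator (fun _ => (1 : ℝ)) i) / n)
        atTop (𝓝 0) ∧
      Tendsto T (atTop ⊓ 𝓟 {n : ℕ | n ∉ J}) (𝓝 0) := by
  set s : ℕ → ℝ := fun n => (∑ i ∈ Finset.range n, T i) / n with hs
  have hs0 : ∀ n, 0 ≤ s n := fun n =>
    div_nonneg (Finset.sum_nonneg fun i _ => hT0 i) (Nat.cast_nonneg n)
  have hslim : ∀ ε > 0, ∃ n₀ : ℕ, ∀ n ≥ n₀, s n ≤ ε := by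
    intro ε hε
    obtain ⟨K, hK⟩ := hT (ε / 2) (half_pos hε)
    obtain ⟨n₀, hn₀⟩ := exists_nat_gt (2 * K / ε)
    refine ⟨n₀ + 1, fun n hn => ?_⟩
    have hn' : (n₀ : ℝ) + 1 ≤ n := by exact_mod_cast hn
    have hnpos : (0 : ℝ) < n := by linarith [(Nat.cast_nonneg n₀ : (0 : ℝ) ≤ n₀)]
    rw [hs, div_le_iff₀ hnpos]
    rw [div_lt_iff₀ hε] at hn₀
    have h1 : (n₀ : ℝ) * ε ≤ n * ε := by gcongr; linarith
    linarith [hK n]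
  have hst : Tendsto s atTop (𝓝 0) := by
    rw [Metric.tendsto_atTop]
    intro ε hε
    obtain ⟨n₀, hn₀⟩ := hslim (ε / 2) (half_pos hε)
    refine ⟨n₀, fun n hn => ?_⟩
    rw [Real.dist_0_eq_abs, abs_of_nonneg (hs0 n)]
    linarith [hn₀ n hn]
  have hbdd : ∀ n, BddAbove (range fun k => s (n + k)) := fun n =>
    hst.bddAbove_range.mono (by rintro _ ⟨k, rfl⟩; exact ⟨n + k, rfl⟩)
  set t : ℕ → ℝ := fun n => (⨆ k, s (n + k)) + 1 / ((n : ℝ) + 1) with ht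
  have hst_le : ∀ n, s n ≤ t n := fun n => by
    have h1 : s n ≤ ⨆ k, s (n + k) := le_ciSup (hbdd n) 0
    have h2 : (0 : ℝ) ≤ 1 / ((n : ℝ) + 1) := by positivity
    simp only [ht]
    linarith
  have htpos : ∀ n, 0 < t n := fun n => by
    have h1 : 0 ≤ ⨆ k, s (n + k) := Real.iSup_nonneg fun k => hs0 _
    have h2 : (0 : ℝ) < 1 / ((n : ℝ) + 1) := by positivity
    simp only [ht]
    linarith
  have htanti : Antitone t := by
    intro a b hab
    simp only [ht]
    gcongr ?_ + ?_
    · refine ciSup_le fun k => ?_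
      have := le_ciSup (hbdd a) (b - a + k)
      rwa [show a + (b - a + k) = b + k by omega] at this
    · gcongr
  have htlim : Tendsto t atTop (𝓝 0) := by
    have h1 : Tendsto (fun n => ⨆ k, s (n + k)) atTop (𝓝 0) := by
      rw [Metric.tendsto_atTop]
      intro ε hε
      obtain ⟨n₀, hn₀⟩ := hslim (ε / 2) (half_pos hε)
      refine ⟨n₀, fun n hn => ?_⟩
      rw [Real.dist_0_eq_abs, abs_of_nonneg (Real.iSup_nonneg fun k => hs0 _)]
      have : ⨆ k, s (n + k) ≤ ε / 2 := ciSup_le fun k => hn₀ _ (by omega)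
      linarith
    have h2 := h1.add (tendsto_one_div_add_atTop_nhds_zero_nat (𝕜 := ℝ))
    rwa [add_zero] at h2
  have hsqrt : Tendsto (fun n => √(t n)) atTop (𝓝 0) := by
    have h1 := (Real.continuous_sqrt.tendsto 0).comp htlim
    rwa [Real.sqrt_zero] at h1
  refine ⟨{n | √(t n) < T n}, ?_, ?_⟩
  · have hind0 : ∀ i, 0 ≤ ({n | √(t n) < T n} : Set ℕ).indicator (fun _ => (1 : ℝ)) i := fun i =>
      indicator_nonneg (fun _ _ => zero_le_one) i
    refine squeeze_zero (fun n => div_nonneg (Finset.sum_nonneg fun i _ => hind0 i)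
      (Nat.cast_nonneg n)) (fun n => ?_) hsqrt
    rcases n.eq_zero_or_pos with rfl | hn
    · simp
    have hn' : (0 : ℝ) < n := by exact_mod_cast hn
    have hsq : 0 < √(t n) := Real.sqrt_pos.2 (htpos n)
    rw [div_le_iff₀ hn', ← mul_le_mul_iff_right₀ hsq]
    calc √(t n) * ∑ i ∈ Finset.range n, ({n | √(t n) < T n} : Set ℕ).indicator (fun _ => (1 : ℝ)) i
        ≤ ∑ i ∈ Finset.range n, T i := by
          rw [Finset.mul_sum]
          refine Finset.sum_le_sum fun i hi => ?_
          by_cases hiJ : i ∈ ({n | √(t n) < T n} : Set ℕ)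
          · rw [indicator_of_mem hiJ, mul_one]
            have h1 : √(t i) < T i := hiJ
            exact (Real.sqrt_le_sqrt (htanti (Finset.mem_range.1 hi).le)).trans h1.le
          · rw [indicator_of_notMem hiJ, mul_zero]
            exact hT0 i
      _ = s n * n := by rw [hs]; field_simp
      _ ≤ t n * n := by gcongr; exact hst_le n
      _ = √(t n) * (√(t n) * n) := by rw [← mul_assoc, Real.mul_self_sqrt (htpos n).le]
  · refine squeeze_zero' (.of_forall hT0) ?_ (hsqrt.mono_left inf_le_left)
    refine (eventually_principal.2 fun n hn => ?_ : ∀ᶠ n in 𝓟 _, T n ≤ √(t n)).filter_mono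
      inf_le_right
    exact not_lt.1 hn

section Measurability

variable {Θ : Type*} [MeasurableSpace Θ] {γ : Θ → Θ} {A : Θ → Matrix (Fin 2) (Fin 2) ℝ}
  {h : ℝ → ℝ} {β : ℝ}

theorem measurable_coc (hγ : Measurable γ) (hA : ∀ i j, Measurable fun θ => A θ i j) (n : ℕ)
    (i j : Fin 2) : Measurable fun θ => coc γ A n θ i j := by
  induction n generalizing i j with
  | zero => exact measurable_const
  | succ n ih =>
    simp only [coc, Matrix.mul_apply, Fin.sum_univ_two]
    exact (((ih i 0).comp hγ).mul (hA 0 j)).add (((ih i 1).comp hγ).mul (hA 1 j))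

theorem measurable_log_opNorm_coc (hγ : Measurable γ) (hA : ∀ i j, Measurable fun θ => A θ i j)
    (n : ℕ) : Measurable fun θ => Real.log (opNorm (coc γ A n θ)) := by
  refine Real.measurable_log.comp ?_
  have h1 : Continuous fun M : Fin 2 → Fin 2 → ℝ => opNorm (Matrix.of M) := continuous_opNorm
  exact h1.measurable.comp (measurable_pi_lambda _ fun i => measurable_pi_lambda _ fun j =>
    measurable_coc hγ hA n i j)

theorem measurable_mulVecE {M : Θ → Matrix (Fin 2) (Fin 2) ℝ} {g : Θ → R2}
    (hM : ∀ i j, Measurable fun θ => M θ i j) (hg : Measurable g) :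
    Measurable fun θ => mulVecE (M θ) (g θ) := by
  have hgi : ∀ i, Measurable fun θ => g θ i := fun i =>
    (EuclideanSpace.proj (𝕜 := ℝ) i).continuous.measurable.comp hg
  refine (MeasurableEquiv.toLp 2 (Fin 2 → ℝ)).measurable.comp (measurable_pi_lambda _ fun i => ?_)
  simp only [Matrix.mulVec, dotProduct, Fin.sum_univ_two]
  exact ((hM i 0).mul (hgi 0)).add ((hM i 1).mul (hgi 1))

theorem measurable_iterFib (hγ : Measurable γ) (hA : ∀ i j, Measurable fun θ => A θ i j)
    (hh : GoodH h) (hβ : 0 < β) (n : ℕ) (v : R2) :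
    Measurable fun θ => iterFib γ A h β n θ v := by
  induction n with
  | zero => exact measurable_const
  | succ n ih =>
    simp only [iterFib_succ, fibMap_eq_smul]
    have hmax : Measurable fun x => h (max 0 x) :=
      (hh.continuousOn.comp_continuous (continuous_const.max continuous_id)
        fun x => mem_Ici.2 (le_max_left _ _)).measurable
    have hnum : Measurable fun θ => h (β * ‖iterFib γ A h β n θ v‖) := by
      convert hmax.comp (ih.norm.const_mul β) using 2 with θ
      simp only [Function.comp_apply]
      rw [max_eq_right (by positivity)]
    exact (hnum.div ih.norm).smul
      (measurable_mulVecE (fun i j => (hA i j).comp (hγ.iterate n)) ih)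

end Measurability

section Growth

variable {Θ : Type*} {γ : Θ → Θ} {A : Θ → Matrix (Fin 2) (Fin 2) ℝ}

theorem log_opNorm_coc_nonneg (hdet : ∀ θ, (A θ).det = 1) (n : ℕ) (θ : Θ) :
    0 ≤ Real.log (opNorm (coc γ A n θ)) :=
  Real.log_nonneg (one_le_opNorm (det_coc hdet n θ))

theorem log_opNorm_coc_add_le (hdet : ∀ θ, (A θ).det = 1) (m n : ℕ) (θ : Θ) :
    Real.log (opNorm (coc γ A (m + n) θ)) ≤
      Real.log (opNorm (coc γ A m (γ^[n] θ))) + Real.log (opNorm (coc γ A n θ)) := by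
  have hpos : ∀ k θ, 0 < opNorm (coc γ A k θ) := fun k θ =>
    zero_lt_one.trans_le (one_le_opNorm (det_coc hdet k θ))
  rw [← Real.log_mul (hpos _ _).ne' (hpos _ _).ne', coc_add]
  refine Real.log_le_log ?_ (opNorm_mul_le _ _)
  rw [← coc_add]
  exact hpos _ _

theorem exists_log_opNorm_coc_le (hdet : ∀ θ, (A θ).det = 1)
    (hA : ∃ C : ℝ, ∀ θ, opNorm (A θ) ≤ C) :
    ∃ C, 0 ≤ C ∧ ∀ n θ, Real.log (opNorm (coc γ A n θ)) ≤ n * C := by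
  obtain ⟨C, hC⟩ := hA
  refine ⟨max 0 (Real.log C), le_max_left _ _, fun n θ => ?_⟩
  induction n with
  | zero => simp [coc, opNorm]
  | succ n ih =>
    rw [add_comm n 1]
    refine (log_opNorm_coc_add_le hdet 1 n θ).trans ?_
    have h1 : Real.log (opNorm (coc γ A 1 (γ^[n] θ))) ≤ max 0 (Real.log C) := by
      rw [coc_one]
      exact (Real.log_le_log (zero_lt_one.trans_le (one_le_opNorm (hdet _))) (hC _)).trans
        (le_max_right _ _)
    push_cast
    linarith

theorem sum_log_opNorm_coc_le (hdet : ∀ θ, (A θ).det = 1) (N n : ℕ) (θ : Θ) :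
    ∑ s ∈ Finset.range N, Real.log (opNorm (coc γ A (n + s) θ)) ≤
      (∑ s ∈ Finset.range N, Real.log (opNorm (coc γ A s θ))) +
        birkhoffSum γ (fun θ => Real.log (opNorm (coc γ A N θ))) n θ := by
  induction n with
  | zero => simp
  | succ n ih =>
    have h1 := Finset.sum_range_succ (fun s => Real.log (opNorm (coc γ A (n + s) θ))) N
    have h2 := Finset.sum_range_succ' (fun s => Real.log (opNorm (coc γ A (n + s) θ))) N
    have h3 := log_opNorm_coc_add_le (γ := γ) hdet N n θ
    rw [add_comm N n] at h3
    rw [birkhoffSum_succ]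
    simp only [add_zero] at h2
    simp only [add_right_comm n 1, add_assoc n] at h2 ⊢
    linarith

/-- The upper bound in the Furstenberg–Kesten theorem. -/
theorem ae_log_opNorm_coc_le [MeasurableSpace Θ] {m : Measure Θ} [IsProbabilityMeasure m]
    (herg : Ergodic γ m) (hdet : ∀ θ, (A θ).det = 1)
    (hAmeas : ∀ i j, Measurable fun θ => A θ i j) (hA : ∃ C : ℝ, ∀ θ, opNorm (A θ) ≤ C) {lam : ℝ}
    (hlam : Tendsto (fun n : ℕ => (∫ θ, Real.log (opNorm (coc γ A n θ)) ∂m) / n) atTop (𝓝 lam))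
    (hpos : 0 < lam) :
    ∀ᵐ θ ∂m, ∀ ε > 0, ∃ K, ∀ n : ℕ,
      Real.log (opNorm (coc γ A n θ)) ≤ K + (lam + ε) * n := by
  obtain ⟨C, hC0, hC⟩ := exists_log_opNorm_coc_le (γ := γ) hdet hA
  have key : ∀ ε > 0, ∀ᵐ θ ∂m, ∃ K, ∀ n : ℕ,
      Real.log (opNorm (coc γ A n θ)) ≤ K + (lam + ε) * n := by
    intro ε hε
    obtain ⟨N, hN, hN0⟩ := ((hlam.eventually_lt_const (lt_add_of_pos_right lam hε)).and
      (eventually_gt_atTop 0)).exists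
    have hN' : (0 : ℝ) < N := by exact_mod_cast hN0
    rw [div_lt_iff₀ hN'] at hN
    filter_upwards [ae_exists_birkhoffSum_le herg
      (measurable_log_opNorm_coc herg.measurable hAmeas N) (C := N * C)
      (fun θ => by rw [abs_of_nonneg (log_opNorm_coc_nonneg hdet N θ)]; exact hC N θ) hN]
      with θ ⟨K, hK⟩
    set W := ∑ s ∈ Finset.range N, Real.log (opNorm (coc γ A s θ)) with hW
    set L := (W + K) / N + N * C with hL
    refine ⟨max (N * C) L, fun n => ?_⟩
    have hlε : 0 ≤ lam + ε := by positivity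
    rcases lt_or_ge n N with hn | hn
    · have h1 : (n : ℝ) * C ≤ N * C := by gcongr
      have h2 : 0 ≤ (lam + ε) * n := by positivity
      linarith [hC n θ, le_max_left (N * C) L]
    · obtain ⟨k, rfl⟩ := Nat.exists_eq_add_of_le' hn
      have h1 : ∀ s ∈ Finset.range N, Real.log (opNorm (coc γ A (k + N) θ)) - N * C ≤
          Real.log (opNorm (coc γ A (k + s) θ)) := by
        intro s hs
        have hs' := (Finset.mem_range.1 hs).le
        have h2 := log_opNorm_coc_add_le (γ := γ) hdet (N - s) (k + s) θ
        rw [show N - s + (k + s) = k + N by omega] at h2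
        have h3 := hC (N - s) (γ^[k + s] θ)
        have h4 : ((N - s : ℕ) : ℝ) * C ≤ N * C := by gcongr; omega
        linarith
      have h2 := Finset.card_nsmul_le_sum _ _ _ h1
      rw [Finset.card_range, nsmul_eq_mul] at h2
      have h3 := sum_log_opNorm_coc_le (γ := γ) hdet N k θ
      have h4 := hK k
      have h5 : N * (Real.log (opNorm (coc γ A (k + N) θ)) - N * C) ≤
          N * ((W + K) / N + (lam + ε) * k) := by
        rw [mul_add, mul_div_cancel₀ _ hN'.ne']
        linarith
      have h6 := le_of_mul_le_mul_left h5 hN'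
      have h7 := le_max_right (N * C) L
      push_cast
      have h8 : 0 ≤ (lam + ε) * N := by positivity
      linarith
  have key' : ∀ᵐ θ ∂m, ∀ j : ℕ, ∃ K, ∀ n : ℕ,
      Real.log (opNorm (coc γ A n θ)) ≤ K + (lam + 1 / ((j : ℝ) + 1)) * n :=
    ae_all_iff.2 fun j => key _ Nat.one_div_pos_of_nat
  filter_upwards [key'] with θ hθ ε hε
  obtain ⟨j, hj⟩ := exists_nat_one_div_lt hε
  obtain ⟨K, hK⟩ := hθ j
  refine ⟨K, fun n => (hK n).trans ?_⟩
  gcongr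

end Growth

/-- The largest norm attained on the pullback of the unit ball. -/
def pullbackNorm {Θ : Type*} (γ : Θ ≃ Θ) (A : Θ → Matrix (Fin 2) (Fin 2) ℝ) (h : ℝ → ℝ) (β : ℝ)
    (n : ℕ) (θ : Θ) : ℝ :=
  sSup (norm '' pullbackBall γ A h β n θ)

section PullbackNorm

variable {Θ : Type*} {γ : Θ ≃ Θ} {A : Θ → Matrix (Fin 2) (Fin 2) ℝ} {h : ℝ → ℝ} {β : ℝ}

theorem norm_le_pullbackNorm (hh : GoodH h) (hβ : 0 < β) {n : ℕ} {θ : Θ} {x : R2}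
    (hx : x ∈ pullbackBall γ A h β n θ) : ‖x‖ ≤ pullbackNorm γ A h β n θ :=
  le_csSup ((isCompact_pullbackBall hh hβ n θ).image continuous_norm).bddAbove
    (mem_image_of_mem _ hx)

theorem pullbackNorm_le_iff (hh : GoodH h) (hβ : 0 < β) {n : ℕ} {θ : Θ} {c : ℝ} :
    pullbackNorm γ A h β n θ ≤ c ↔ ∀ x ∈ pullbackBall γ A h β n θ, ‖x‖ ≤ c := by
  refine ⟨fun H x hx => (norm_le_pullbackNorm hh hβ hx).trans H, fun H => ?_⟩
  refine csSup_le (Nonempty.image _ ⟨0, zero_mem_pullbackBall n θ⟩) ?_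
  rintro _ ⟨x, hx, rfl⟩
  exact H x hx

theorem exists_norm_eq_pullbackNorm (hh : GoodH h) (hβ : 0 < β) (n : ℕ) (θ : Θ) :
    ∃ x ∈ pullbackBall γ A h β n θ, ‖x‖ = pullbackNorm γ A h β n θ :=
  ((isCompact_pullbackBall hh hβ n θ).image continuous_norm).sSup_mem
    (Nonempty.image _ ⟨0, zero_mem_pullbackBall n θ⟩)

theorem pullbackNorm_nonneg (hh : GoodH h) (hβ : 0 < β) (n : ℕ) (θ : Θ) :
    0 ≤ pullbackNorm γ A h β n θ := by
  simpa using norm_le_pullbackNorm hh hβ (zero_mem_pullbackBall n θ)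

theorem pullbackNorm_le_one (hA : ∃ C : ℝ, ∀ θ, opNorm (A θ) ≤ C) (hdet : ∀ θ, (A θ).det = 1)
    (hh : GoodH h) (hscale : Scaled A h) (hβ : 0 < β) (n : ℕ) (θ : Θ) :
    pullbackNorm γ A h β n θ ≤ 1 := by
  rw [pullbackNorm_le_iff hh hβ]
  rintro _ ⟨v, hv, rfl⟩
  exact norm_iterFib_le_one hA hdet hh hscale hβ _ _ (mem_closedBall_zero_iff.1 hv)

theorem antitone_pullbackNorm (hA : ∃ C : ℝ, ∀ θ, opNorm (A θ) ≤ C) (hdet : ∀ θ, (A θ).det = 1)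
    (hh : GoodH h) (hscale : Scaled A h) (hβ : 0 < β) (θ : Θ) :
    Antitone fun n => pullbackNorm γ A h β n θ := fun _ _ hab =>
  (pullbackNorm_le_iff hh hβ).2 fun _ hx =>
    norm_le_pullbackNorm hh hβ (antitone_pullbackBall hA hdet hh hscale hβ θ hab hx)

theorem norm_iterFib_succ_le (hA : ∃ C : ℝ, ∀ θ, opNorm (A θ) ≤ C) (hdet : ∀ θ, (A θ).det = 1)
    (hh : GoodH h) (hscale : Scaled A h) (hβ : 0 < β) (n : ℕ) (θ : Θ) (v : R2) :
    ‖iterFib γ A h β (n + 1) θ v‖ ≤ pullbackNorm γ A h β n (γ^[n + 1] θ) := by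
  rw [iterFib_succ', Function.iterate_succ_apply]
  exact norm_le_pullbackNorm hh hβ
    (iterFib_mem_pullbackBall n (γ θ) (norm_fibMap_le_one hA hdet hh hscale hβ θ v))

theorem exists_mem_attractorFib_le_norm (hA : ∃ C : ℝ, ∀ θ, opNorm (A θ) ≤ C)
    (hdet : ∀ θ, (A θ).det = 1) (hh : GoodH h) (hscale : Scaled A h) (hβ : 0 < β) {θ : Θ} {δ : ℝ}
    (hδ : ∀ n, δ ≤ pullbackNorm γ A h β n θ) : ∃ x ∈ attractorFib γ A h β θ, δ ≤ ‖x‖ := by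
  have hcl : IsClosed {x : R2 | δ ≤ ‖x‖} := isClosed_le continuous_const continuous_norm
  obtain ⟨x, hx⟩ := IsCompact.nonempty_iInter_of_sequence_nonempty_isCompact_isClosed
    (fun n => pullbackBall γ A h β n θ ∩ {x : R2 | δ ≤ ‖x‖})
    (fun n => inter_subset_inter_left _
      (antitone_pullbackBall hA hdet hh hscale hβ θ n.le_succ))
    (fun n => by
      obtain ⟨x, hx, hxn⟩ := exists_norm_eq_pullbackNorm (γ := γ) (A := A) hh hβ n θ
      exact ⟨x, hx, (hδ n).trans hxn.ge⟩)
    ((isCompact_pullbackBall hh hβ 0 θ).inter_right hcl)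
    (fun n => (isCompact_pullbackBall hh hβ n θ).isClosed.inter hcl)
  rw [mem_iInter] at hx
  refine ⟨x, ?_, (hx 0).2⟩
  rw [attractorFib_eq_iInter, mem_iInter]
  exact fun n => (hx n).1

theorem attractorFib_eq_singleton_zero (hh : GoodH h) (hβ : 0 < β) {θ : Θ}
    (hθ : Tendsto (fun n => pullbackNorm γ A h β n θ) atTop (𝓝 0)) :
    attractorFib γ A h β θ = {0} := by
  refine subset_antisymm (fun x hx => ?_) (singleton_subset_iff.2 (zero_mem_attractorFib θ))
  rw [attractorFib_eq_iInter, mem_iInter] at hx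
  exact norm_le_zero_iff.1 (ge_of_tendsto' hθ fun n => norm_le_pullbackNorm hh hβ (hx n))

variable [MeasurableSpace Θ]

theorem measurable_pullbackNorm (hγ : Measurable γ) (hγ' : Measurable γ.symm)
    (hA : ∀ i j, Measurable fun θ => A θ i j) (hh : GoodH h) (hβ : 0 < β) (n : ℕ) :
    Measurable (pullbackNorm γ A h β n) := by
  have : Nonempty (closedBall (0 : R2) 1) := ⟨⟨0, by simp⟩⟩
  refine measurable_of_Iic fun c => ?_
  have heq : pullbackNorm γ A h β n ⁻¹' Iic c = ⋂ i : ℕ, {θ | ‖iterFib γ A h β n (γ.symm^[n] θ)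
      (TopologicalSpace.denseSeq (closedBall (0 : R2) 1) i)‖ ≤ c} := by
    ext θ
    simp only [mem_preimage, mem_Iic, pullbackNorm_le_iff hh hβ, mem_iInter, mem_ofPred_eq]
    constructor
    · exact fun H i => H _ ⟨_, (TopologicalSpace.denseSeq (closedBall (0 : R2) 1) i).2, rfl⟩
    · rintro H _ ⟨v, hv, rfl⟩
      have hcl : IsClosed {w : closedBall (0 : R2) 1 |
          ‖iterFib γ A h β n (γ.symm^[n] θ) w‖ ≤ c} :=
        isClosed_le ((continuous_iterFib hh hβ _ _).comp continuous_subtype_val).norm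
          continuous_const
      exact (TopologicalSpace.denseRange_denseSeq (closedBall (0 : R2) 1)).induction_on
        (p := fun w => ‖iterFib γ A h β n (γ.symm^[n] θ) w‖ ≤ c) ⟨v, hv⟩ hcl H
  rw [heq]
  exact .iInter fun i => measurableSet_le
    (((measurable_iterFib hγ hA hh hβ n _).comp (hγ'.iterate n)).norm) measurable_const

variable {m : Measure Θ} [IsProbabilityMeasure m] {lam : ℝ}

theorem ae_exists_pullbackNorm_lt (hγ' : Measurable γ.symm) (herg : Ergodic γ m)
    (hdet : ∀ θ, (A θ).det = 1) (hAmeas : ∀ i j, Measurable fun θ => A θ i j)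
    (hA : ∃ C : ℝ, ∀ θ, opNorm (A θ) ≤ C) (hh : GoodH h) (hscale : Scaled A h)
    (hlam : Tendsto (fun n : ℕ => (∫ θ, Real.log (opNorm (coc γ A n θ)) ∂m) / n) atTop (𝓝 lam))
    (hpos : 0 < lam) (hβ : β = Real.exp (-lam)) {δ : ℝ} (hδ : 0 < δ) :
    ∀ᵐ θ ∂m, ∃ n, pullbackNorm γ A h β n θ < δ := by
  have hβ0 : 0 < β := hβ ▸ Real.exp_pos _
  have hβ1 : β < 1 := by rw [hβ, Real.exp_lt_one_iff]; linarith
  set E : Set Θ := ⋂ n, {θ | δ ≤ pullbackNorm γ A h β n θ} with hE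
  have hEm : MeasurableSet E := .iInter fun n => measurableSet_le measurable_const
    (measurable_pullbackNorm herg.measurable hγ' hAmeas hh hβ0 n)
  suffices H : m E = 0 by
    filter_upwards [measure_eq_zero_iff_ae_notMem.1 H] with θ hθ
    simpa [hE] using hθ
  by_contra hne
  have hpE : 0 < m.real E := ENNReal.toReal_pos hne (measure_ne_top _ _)
  have hint : ∫ θ, -E.indicator (fun _ => (1 : ℝ)) θ ∂m < -(m.real E / 2) := by
    rw [integral_neg, integral_indicator_const _ hEm, smul_eq_mul, mul_one]
    linarith
  have hbd : ∀ θ, |(-E.indicator (fun _ => (1 : ℝ)) θ)| ≤ 1 := fun θ => by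
    by_cases hθ : θ ∈ E <;> simp [hθ]
  obtain ⟨θ, hθ, K₁, hK₁⟩ := ((ae_log_opNorm_coc_le herg hdet hAmeas hA hlam hpos).and
    (ae_exists_birkhoffSum_le herg (measurable_const.indicator hEm).neg hbd hint)).exists
  obtain ⟨K₂, hK₂⟩ := exists_card_visits_le hdet hh hβ hδ hθ (ε := m.real E / 4) (by positivity)
  obtain ⟨x, hx, hmax⟩ := exists_isMaxOn_attractorFib (γ := γ) (A := A) hh hβ0 θ
  have hx1 : ‖x‖ ≤ 1 := by
    rw [attractorFib_eq_iInter, mem_iInter] at hx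
    exact (norm_le_pullbackNorm hh hβ0 (hx 0)).trans
      (pullbackNorm_le_one hA hdet hh hscale hβ0 0 θ)
  have hvisit : ∀ i, E.indicator (fun _ => (1 : ℝ)) (γ^[i] θ) ≤
      if δ ≤ ‖iterFib γ A h β i θ x‖ then 1 else 0 := by
    intro i
    by_cases hi : γ^[i] θ ∈ E
    · obtain ⟨y, hy, hyδ⟩ := exists_mem_attractorFib_le_norm hA hdet hh hscale hβ0
        (mem_iInter.1 hi)
      have := hyδ.trans ((isMaxOn_iterFib hA hdet hh hscale hβ0 hβ1 hx hmax i).2 hy)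
      rw [indicator_of_mem hi, if_pos this]
    · rw [indicator_of_notMem hi]
      split_ifs <;> norm_num
  have hsum : ∀ n : ℕ, m.real E / 4 * n ≤ K₁ + K₂ := by
    intro n
    have h1 := hK₁ n
    have h2 := hK₂ x hx1 n
    have h3 := Finset.sum_le_sum fun i (_ : i ∈ Finset.range n) => hvisit i
    rw [Finset.sum_boole] at h3
    simp only [birkhoffSum, Pi.neg_apply, Finset.sum_neg_distrib] at h1
    linarith
  obtain ⟨n, hn⟩ := exists_nat_gt ((K₁ + K₂) / (m.real E / 4))
  rw [div_lt_iff₀ (by positivity)] at hn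
  linarith [hsum n]

theorem ae_tendsto_pullbackNorm (hγ' : Measurable γ.symm) (herg : Ergodic γ m)
    (hdet : ∀ θ, (A θ).det = 1) (hAmeas : ∀ i j, Measurable fun θ => A θ i j)
    (hA : ∃ C : ℝ, ∀ θ, opNorm (A θ) ≤ C) (hh : GoodH h) (hscale : Scaled A h)
    (hlam : Tendsto (fun n : ℕ => (∫ θ, Real.log (opNorm (coc γ A n θ)) ∂m) / n) atTop (𝓝 lam))
    (hpos : 0 < lam) (hβ : β = Real.exp (-lam)) :
    ∀ᵐ θ ∂m, Tendsto (fun n => pullbackNorm γ A h β n θ) atTop (𝓝 0) := by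
  have hβ0 : 0 < β := hβ ▸ Real.exp_pos _
  have H : ∀ᵐ θ ∂m, ∀ j : ℕ, ∃ n, pullbackNorm γ A h β n θ < 1 / ((j : ℝ) + 1) :=
    ae_all_iff.2 fun j => ae_exists_pullbackNorm_lt hγ' herg hdet hAmeas hA hh hscale hlam hpos hβ
      Nat.one_div_pos_of_nat
  filter_upwards [H] with θ hθ
  rw [Metric.tendsto_atTop]
  intro ε hε
  obtain ⟨j, hj⟩ := exists_nat_one_div_lt hε
  obtain ⟨n₀, hn₀⟩ := hθ j
  refine ⟨n₀, fun n hn => ?_⟩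
  rw [Real.dist_0_eq_abs, abs_of_nonneg (pullbackNorm_nonneg hh hβ0 n θ)]
  exact (antitone_pullbackNorm hA hdet hh hscale hβ0 θ hn).trans_lt (hn₀.trans hj)

theorem ae_sum_pullbackNorm_le (hγ' : Measurable γ.symm) (herg : Ergodic γ m)
    (hdet : ∀ θ, (A θ).det = 1) (hAmeas : ∀ i j, Measurable fun θ => A θ i j)
    (hA : ∃ C : ℝ, ∀ θ, opNorm (A θ) ≤ C) (hh : GoodH h) (hscale : Scaled A h) (hβ : 0 < β)
    (hlim : ∀ᵐ θ ∂m, Tendsto (fun n => pullbackNorm γ A h β n θ) atTop (𝓝 0)) :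
    ∀ᵐ θ ∂m, ∀ ε > 0, ∃ K, ∀ n : ℕ,
      ∑ i ∈ Finset.range n, pullbackNorm γ A h β (i - 1) (γ^[i] θ) ≤ K + ε * n := by
  have hmeas := measurable_pullbackNorm herg.measurable hγ' hAmeas hh hβ
  have hbd : ∀ k θ, |pullbackNorm γ A h β k θ| ≤ 1 := fun k θ => by
    rw [abs_of_nonneg (pullbackNorm_nonneg hh hβ k θ)]
    exact pullbackNorm_le_one hA hdet hh hscale hβ k θ
  have hint : Tendsto (fun k => ∫ θ, pullbackNorm γ A h β k θ ∂m) atTop (𝓝 0) := by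
    have := tendsto_integral_of_dominated_convergence (fun _ => (1 : ℝ))
      (fun k => (hmeas k).aestronglyMeasurable) (integrable_const _)
      (fun k => .of_forall (hbd k)) hlim
    simpa using this
  have H : ∀ᵐ θ ∂m, ∀ j : ℕ, ∃ k K, ∀ n : ℕ,
      birkhoffSum γ (pullbackNorm γ A h β k) n θ ≤ K + 1 / ((j : ℝ) + 1) * n := by
    refine ae_all_iff.2 fun j => ?_
    obtain ⟨k, hk⟩ := (hint.eventually_lt_const
      (Nat.one_div_pos_of_nat : (0 : ℝ) < 1 / ((j : ℝ) + 1))).exists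
    filter_upwards [ae_exists_birkhoffSum_le herg (hmeas k) (hbd k) hk] with θ hθ
    exact ⟨k, hθ⟩
  filter_upwards [H] with θ hθ ε hε
  obtain ⟨j, hj⟩ := exists_nat_one_div_lt hε
  obtain ⟨k, K, hK⟩ := hθ j
  have hterm : ∀ i, pullbackNorm γ A h β (i - 1) (γ^[i] θ) ≤
      pullbackNorm γ A h β k (γ^[i] θ) + if i ≤ k then 1 else 0 := by
    intro i
    split_ifs with hi
    · linarith [pullbackNorm_le_one (γ := γ) hA hdet hh hscale hβ (i - 1) (γ^[i] θ),
        pullbackNorm_nonneg (γ := γ) (A := A) hh hβ k (γ^[i] θ)]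
    · rw [add_zero]
      exact antitone_pullbackNorm hA hdet hh hscale hβ _ (by omega)
  refine ⟨K + (k + 1), fun n => ?_⟩
  have hcard : (((Finset.range n).filter fun i => i ≤ k).card : ℝ) ≤ k + 1 := by
    have : ((Finset.range n).filter fun i => i ≤ k) ⊆ Finset.range (k + 1) := fun i hi => by
      rw [Finset.mem_filter] at hi
      exact Finset.mem_range.2 (by omega)
    have h1 := Finset.card_le_card this
    rw [Finset.card_range] at h1
    exact_mod_cast h1
  have h1 := Finset.sum_le_sum fun i (_ : i ∈ Finset.range n) => hterm i
  rw [Finset.sum_add_distrib, Finset.sum_boole] at h1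
  have h2 := hK n
  rw [birkhoffSum] at h2
  have h3 : 1 / ((j : ℝ) + 1) * n ≤ ε * n := by gcongr
  linarith

end PullbackNorm

/-- If `β = β₁^m < β₂^m`, then for m-a.e. θ the attractor fibre is `{0}`
and forward orbits tend to 0 along a sequence of asymptotic density 1. -/
theorem stmt6 {Θ : Type*} [MeasurableSpace Θ]
    (γ : Θ ≃ Θ) (hγ : Measurable ⇑γ) (hγ' : Measurable ⇑γ.symm)
    (m : Measure Θ) [IsProbabilityMeasure m] (herg : Ergodic ⇑γ m)
    (A : Θ → Matrix (Fin 2) (Fin 2) ℝ) (hdet : ∀ θ, (A θ).det = 1)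
    (hAmeas : ∀ i j, Measurable fun θ => A θ i j)
    (hAbdd : ∃ C : ℝ, ∀ θ, opNorm (A θ) ≤ C)
    (h : ℝ → ℝ) (hh : GoodH h) (hscale : Scaled A h)
    (lam : ℝ)
    (hlam : Filter.Tendsto
      (fun n : ℕ => (∫ θ, Real.log (opNorm (coc ⇑γ A n θ)) ∂m) / n)
      Filter.atTop (𝓝 lam))
    (hpos : 0 < lam) (β : ℝ) (hβ : β = Real.exp (-lam)) :
    ∀ᵐ θ ∂m,
      attractorFib ⇑γ A h β θ = {0} ∧
      ∃ J : Set ℕ,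
        Filter.Tendsto
          (fun n : ℕ => (∑ i ∈ Finset.range n, J.indicator (fun _ => (1 : ℝ)) i) / n)
          Filter.atTop (𝓝 0) ∧
        ∀ v : R2,
          Filter.Tendsto (fun n : ℕ => ‖((skewProd ⇑γ A h β)^[n] (θ, v)).2‖)
            (Filter.atTop ⊓ Filter.principal {n : ℕ | n ∉ J}) (𝓝 0) := by
  have hβ0 : 0 < β := hβ ▸ Real.exp_pos _
  have hlim := ae_tendsto_pullbackNorm hγ' herg hdet hAmeas hAbdd hh hscale hlam hpos hβ
  filter_upwards [hlim,
    ae_sum_pullbackNorm_le hγ' herg hdet hAmeas hAbdd hh hscale hβ0 hlim] with θ hθ hsum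
  refine ⟨attractorFib_eq_singleton_zero hh hβ0 hθ, ?_⟩
  obtain ⟨J, hJ, hT⟩ := exists_density_zero_tendsto_zero
    (T := fun n => pullbackNorm γ A h β (n - 1) (γ^[n] θ))
    (fun n => pullbackNorm_nonneg hh hβ0 _ _) hsum
  refine ⟨J, hJ, fun v => squeeze_zero' (.of_forall fun n => norm_nonneg _) ?_ hT⟩
  filter_upwards [(eventually_ge_atTop 1).filter_mono inf_le_left] with n hn
  obtain ⟨n, rfl⟩ := Nat.exists_eq_add_of_le' hn
  exact norm_iterFib_succ_le hAbdd hdet hh hscale hβ0 n θ v
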